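/- Let g be a filiform Lie algebra of dimension n over a field K of characteristic zero, equipped with a grading g = ⊕_{α≥1} g_α (meaning [g_α, g_β] ⊆ g_{α+β}) such that dim g_1 = 2, dim g_α = 1 for 2 ≤ α ≤ n − 1, and g_α = 0 for α ≥ n. Then: if n is odd, g is isomorphic to m_0(n); if n = 2k is even, g is isomorphic either to m_0(2k) or to m_1(2k). -/

import Mathlib

namespace Paper

open Module Submodule

/-- The lower central series of a Lie algebra, as submodules:
`lcs K g 0 = C¹g = g` and `lcs K g m = C^{m+1} g = [g, C^m g]`. -/
def lcs (K : Type*) [Field K] (g : Type*) [LieRing g] [LieAlgebra K g] :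
    ℕ → Submodule K g
  | 0 => ⊤
  | m + 1 => Submodule.span K {z : g | ∃ x y : g, y ∈ lcs K g m ∧ z = ⁅x, y⁆}

/-- `g` is a filiform Lie algebra of dimension `n`: it is `n`-dimensional, nilpotent,
with nil-index `n - 1`, i.e. `C^{n-1} g ≠ 0` and `C^n g = 0`. -/
def IsFiliform (K : Type*) [Field K] (g : Type*) [LieRing g] [LieAlgebra K g]
    (n : ℕ) : Prop :=
  Module.finrank K g = n ∧ lcs K g (n - 2) ≠ ⊥ ∧ lcs K g (n - 1) = ⊥

variable (K : Type*) [Field K] {g : Type*} [LieRing g] [LieAlgebra K g]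

/-- `E : ℕ → g` enumerates a basis `e_1, …, e_n` of the Lie algebra `m_0(n)`
(with `E m = 0` for `m = 0` or `m > n`): the only nonzero brackets among the basis
vectors are `⁅e_1, e_i⁆ = e_{i+1}` for `2 ≤ i ≤ n - 1`. -/
def IsM0Basis (n : ℕ) (E : ℕ → g) : Prop :=
  (∃ b : Basis (Fin n) K g, ∀ i : Fin n, E ((i : ℕ) + 1) = b i) ∧
  (∀ m : ℕ, m = 0 ∨ n < m → E m = 0) ∧
  (∀ i : ℕ, 2 ≤ i → i ≤ n - 1 → ⁅E 1, E i⁆ = E (i + 1)) ∧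
  ⁅E 1, E n⁆ = 0 ∧
  (∀ i j : ℕ, 2 ≤ i → i < j → j ≤ n → ⁅E i, E j⁆ = 0)

/-- `E : ℕ → g` enumerates a basis `e_1, …, e_{2k}` of the Lie algebra `m_1(2k)`:
the only nonzero brackets among the basis vectors are `⁅e_1, e_i⁆ = e_{i+1}` for
`2 ≤ i ≤ 2k - 1` and `⁅e_j, e_{2k+1-j}⁆ = (-1)^{j+1} e_{2k}` for `2 ≤ j ≤ k`. -/
def IsM1Basis (k : ℕ) (E : ℕ → g) : Prop :=
  (∃ b : Basis (Fin (2 * k)) K g, ∀ i : Fin (2 * k), E ((i : ℕ) + 1) = b i) ∧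
  (∀ m : ℕ, m = 0 ∨ 2 * k < m → E m = 0) ∧
  (∀ i : ℕ, 2 ≤ i → i ≤ 2 * k - 1 → ⁅E 1, E i⁆ = E (i + 1)) ∧
  ⁅E 1, E (2 * k)⁆ = 0 ∧
  (∀ i j : ℕ, 2 ≤ i → i < j → j ≤ 2 * k →
    ⁅E i, E j⁆ = if i + j = 2 * k + 1 then ((-1 : K)) ^ (i + 1) • E (2 * k) else 0)

section core
variable {K : Type*} [Field K] {g : Type*} [LieRing g] [LieAlgebra K g]

theorem core_alt (x : g) (w : ℕ → g) (hs : ∀ k, w (k + 1) = ⁅x, w k⁆)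
    (t : ℕ) (hP : ∀ a b, a + b = t → ⁅w a, w b⁆ = 0) :
    ∀ a b, a + b = t + 1 → ⁅w a, w b⁆ = ((-1 : K)) ^ a • ⁅w 0, w (t + 1)⁆ := by
  intro a
  induction a with
  | zero => intro b hb; obtain rfl : b = t + 1 := by omega
            simp
  | succ a ih =>
    intro b hb
    have h1 := ih (b + 1) (by omega)
    have h2 : ⁅x, ⁅w a, w b⁆⁆ = ⁅w (a + 1), w b⁆ + ⁅w a, w (b + 1)⁆ := by
      rw [hs a, hs b, leibniz_lie]
    rw [hP a b (by omega), lie_zero, h1] at h2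
    rw [pow_succ, mul_neg_one, neg_smul]
    exact eq_neg_of_add_eq_zero_left h2.symm

theorem core_even (K : Type*) [Field K] {g : Type*} [LieRing g] [LieAlgebra K g] (x : g) (w : ℕ → g) (hs : ∀ k, w (k + 1) = ⁅x, w k⁆)
    (t m : ℕ) (ht : t + 1 = 2 * m) (hP : ∀ a b, a + b = t → ⁅w a, w b⁆ = 0) :
    ∀ a b, a + b = t + 1 → ⁅w a, w b⁆ = 0 := by
  intro a b hab
  have hA := core_alt (K := K) x w hs t hP
  have h := hA m m (by omega)
  rw [lie_self] at h
  have h0 : ⁅w 0, w (t + 1)⁆ = 0 := by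
    rcases smul_eq_zero.1 h.symm with h | h
    · exact absurd h (pow_ne_zero _ (by simp))
    · exact h
  rw [hA a b hab, h0, smul_zero]

theorem core_odd [CharZero K] (x : g) (w : ℕ → g) (hs : ∀ k, w (k + 1) = ⁅x, w k⁆)
    (h01 : ⁅w 0, w 1⁆ = 0)
    (hgen : ∀ a b, ∃ c : K, ⁅w a, w b⁆ = c • w (a + b + 1))
    (t m : ℕ) (ht : t + 1 = 2 * m + 1) (hne : w (t + 3) ≠ 0)
    (hP : ∀ a b, a + b = t → ⁅w a, w b⁆ = 0) :
    ∀ a b, a + b = t + 1 → ⁅w a, w b⁆ = 0 := by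
  have hA := core_alt (K := K) x w hs t hP
  suffices h0 : ⁅w 0, w (t + 1)⁆ = 0 by
    intro a b hab
    rw [hA a b hab, h0, smul_zero]
  rcases Nat.eq_zero_or_pos t with rfl | htp
  · exact h01
  obtain ⟨c, hc⟩ := hgen 0 (t + 1)
  rw [show 0 + (t + 1) + 1 = t + 2 by omega] at hc
  have hB : ∀ a b, a + b = t + 2 →
      ⁅w a, w b⁆ = ((-1 : K)) ^ a • (⁅w 0, w (t + 2)⁆ - ((a : K) * c) • w (t + 3)) := by
    intro a
    induction a with
    | zero => intro b hb; obtain rfl : b = t + 2 := by omega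
              simp
    | succ a ih =>
      intro b hb
      have h1 := ih (b + 1) (by omega)
      have h2 : ⁅x, ⁅w a, w b⁆⁆ = ⁅w (a + 1), w b⁆ + ⁅w a, w (b + 1)⁆ := by
        rw [hs a, hs b, leibniz_lie]
      rw [hA a b (by omega), hc, lie_smul, lie_smul, ← hs (t + 2), h1] at h2
      rw [eq_sub_of_add_eq h2.symm]
      push_cast
      module
  have hm := hB (m + 1) (m + 1) (by omega)
  rw [lie_self] at hm
  have hm0 : ⁅w 0, w (t + 2)⁆ = (((m + 1 : ℕ) : K) * c) • w (t + 3) := by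
    rcases smul_eq_zero.1 hm.symm with h | h
    · exact absurd h (pow_ne_zero _ (by simp))
    · exact sub_eq_zero.1 h
  have hJ := leibniz_lie (w 0) (w 1) (w t)
  rw [h01, zero_lie, hP 0 t (by omega), lie_zero, add_zero, hA 1 t (by omega), hc, lie_smul,
    lie_smul, hm0] at hJ
  have hc0 : c = 0 := by
    simp only [smul_smul] at hJ
    rcases smul_eq_zero.1 hJ with h | h
    · have : ((m + 1 : ℕ) : K) ≠ 0 := by exact_mod_cast Nat.succ_ne_zero m
      have h' : (m : K) + 1 ≠ 0 := by exact_mod_cast this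
      simpa [h'] using h
    · exact absurd h hne
  rw [hc, hc0, zero_smul]

theorem core [CharZero K] (n : ℕ) (x : g) (w : ℕ → g) (hs : ∀ k, w (k + 1) = ⁅x, w k⁆)
    (h01 : ⁅w 0, w 1⁆ = 0)
    (hgen : ∀ a b, ∃ c : K, ⁅w a, w b⁆ = c • w (a + b + 1))
    (hne : ∀ k, k + 2 ≤ n → w k ≠ 0) (t : ℕ) :
    t + 4 ≤ n → ∀ a b, a + b = t → ⁅w a, w b⁆ = 0 := by
  induction t with
  | zero =>
    intro _ a b hab
    obtain rfl : a = 0 := by omega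
    obtain rfl : b = 0 := by omega
    exact lie_self _
  | succ t ih =>
    intro hn
    have hP := ih (by omega)
    rcases Nat.even_or_odd' (t + 1) with ⟨m, hm | hm⟩
    · exact core_even K x w hs t m hm hP
    · exact core_odd (K := K) x w hs h01 hgen t m hm (hne _ (by omega)) hP

end core

section grad
variable {K : Type*} [Field K] {g : Type*} [LieRing g] [LieAlgebra K g]

/-- The filtration attached to a grading. -/
def filt (gr : ℕ → Submodule K g) (k : ℕ) : Submodule K g := ⨆ β : {β : ℕ // k ≤ β}, gr β

theorem mem_filt (gr : ℕ → Submodule K g) {k β : ℕ} (h : k ≤ β) {x : g} (hx : x ∈ gr β) :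
    x ∈ filt gr k :=
  (le_iSup (fun β : {β : ℕ // k ≤ β} => gr β) ⟨β, h⟩) hx

theorem lie_filt (gr : ℕ → Submodule K g) (h0 : gr 0 = ⊥) (hsup : (⨆ α : ℕ, gr α) = ⊤)
    (N : Submodule K g) (k : ℕ)
    (h : ∀ γ β x y, 1 ≤ γ → k ≤ β → x ∈ gr γ → y ∈ gr β → ⁅x, y⁆ ∈ N) :
    ∀ x y : g, y ∈ filt gr k → ⁅x, y⁆ ∈ N := by
  intro x y hy
  have hx : x ∈ ⨆ α : ℕ, gr α := hsup ▸ Submodule.mem_top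
  unfold filt at hy
  induction hy using Submodule.iSup_induction' with
  | zero => simp
  | add a b _ _ ha hb => rw [lie_add]; exact N.add_mem ha hb
  | mem β y hy =>
    induction hx using Submodule.iSup_induction' with
    | zero => simp
    | add a b _ _ ha hb => rw [add_lie]; exact N.add_mem ha hb
    | mem γ x hx =>
      rcases Nat.eq_zero_or_pos γ with rfl | hγ
      · rw [h0, Submodule.mem_bot] at hx
        simp [hx]
      · exact h γ β x y hγ β.2 hx hy

theorem lcs_step (N M : Submodule K g) (m : ℕ) (hm : lcs K g m ≤ M)
    (h : ∀ x y : g, y ∈ M → ⁅x, y⁆ ∈ N) : lcs K g (m + 1) ≤ N := by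
  rw [lcs, Submodule.span_le]
  rintro z ⟨x, y, hy, rfl⟩
  exact h x y (hm hy)

theorem exists_lie_ne (n : ℕ) (hl : lcs K g (n - 2) ≠ ⊥)
    (gr : ℕ → Submodule K g)
    (h0 : gr 0 = ⊥)
    (htop : ∀ α : ℕ, n ≤ α → gr α = ⊥)
    (hbr : ∀ (α β : ℕ) (x y : g), x ∈ gr α → y ∈ gr β → ⁅x, y⁆ ∈ gr (α + β))
    (hsup : (⨆ α : ℕ, gr α) = ⊤) (α : ℕ) (hα1 : 1 ≤ α) (hαn : α + 2 ≤ n) :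
    ∃ x ∈ gr 1, ∃ y ∈ gr α, ⁅x, y⁆ ≠ 0 := by
  by_contra! hcon
  have step : ∀ k, ∀ x y : g, y ∈ filt gr k → ⁅x, y⁆ ∈ filt gr (k + 1) := fun k =>
    lie_filt gr h0 hsup _ k fun γ β x y hγ hβ hx hy =>
      mem_filt gr (by omega) (hbr γ β x y hx hy)
  have hF1 : filt gr 1 = ⊤ := by
    rw [eq_top_iff, ← hsup]
    refine iSup_le fun β => ?_
    rcases Nat.eq_zero_or_pos β with rfl | hβ
    · rw [h0]; exact bot_le
    · exact fun x hx => mem_filt gr hβ hx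
  have a1 : ∀ m, lcs K g m ≤ filt gr (m + 1) := by
    intro m
    induction m with
    | zero => rw [hF1]; exact le_top
    | succ m ih => exact lcs_step _ _ m ih (step _)
  have a2 : ∀ j, lcs K g (α + j) ≤ filt gr (α + 2 + j) := by
    intro j
    induction j with
    | zero =>
      obtain ⟨a, rfl⟩ : ∃ a, α = a + 1 := ⟨α - 1, by omega⟩
      refine lcs_step _ _ a (a1 a) (lie_filt gr h0 hsup _ _ ?_)
      intro γ β x y hγ hβ hx hy
      by_cases hc : γ = 1 ∧ β = a + 1
      · obtain ⟨rfl, rfl⟩ := hc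
        rw [hcon x hx y hy]; exact Submodule.zero_mem _
      · exact mem_filt gr (by omega) (hbr γ β x y hx hy)
    | succ j ih => exact lcs_step _ _ (α + j) ih (step _)
  have a3 := a2 (n - 2 - α)
  apply hl
  rw [eq_bot_iff]
  rw [show α + (n - 2 - α) = n - 2 by omega, show α + 2 + (n - 2 - α) = n by omega] at a3
  refine a3.trans (iSup_le fun β => ?_)
  rw [htop β β.2]

end grad

section setup
variable {K : Type*} [Field K] {g : Type*} [LieRing g] [LieAlgebra K g]

theorem setup [CharZero K] (n : ℕ) (hn : 2 ≤ n) (hl : lcs K g (n - 2) ≠ ⊥)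
    (gr : ℕ → Submodule K g)
    (h0 : gr 0 = ⊥)
    (htop : ∀ α : ℕ, n ≤ α → gr α = ⊥)
    (hbr : ∀ (α β : ℕ) (x y : g), x ∈ gr α → y ∈ gr β → ⁅x, y⁆ ∈ gr (α + β))
    (hsup : (⨆ α : ℕ, gr α) = ⊤)
    (h1 : Module.finrank K (gr 1) = 2)
    (hα : ∀ α : ℕ, 2 ≤ α → α ≤ n - 1 → Module.finrank K (gr α) = 1) :
    ∃ (x : g) (w : ℕ → g), (∀ k, w (k + 1) = ⁅x, w k⁆) ∧ ⁅w 0, w 1⁆ = 0 ∧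
      gr 1 ≤ Submodule.span K {x, w 0} ∧ (∀ k, w k ∈ gr (k + 1)) ∧
      (∀ k, k + 2 ≤ n → w k ≠ 0) ∧ (∀ k, 1 ≤ k → gr (k + 1) ≤ Submodule.span K {w k}) := by
  have hex := exists_lie_ne n hl gr h0 htop hbr hsup
  have hf : ∀ α, ∃ f ∈ gr α, 2 ≤ α → gr α ≤ Submodule.span K {f} := by
    intro α
    by_cases h : 2 ≤ α ∧ α ≤ n - 1
    · obtain ⟨v, -, hv⟩ := finrank_eq_one_iff'.1 (hα α h.1 h.2)
      refine ⟨v, v.2, fun _ y hy => ?_⟩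
      obtain ⟨c, hc⟩ := hv ⟨y, hy⟩
      exact Submodule.mem_span_singleton.2 ⟨c, congrArg Subtype.val hc⟩
    · refine ⟨0, Submodule.zero_mem _, fun h2 => ?_⟩
      rw [htop α (by omega)]; exact bot_le
  choose f hfm hfs using hf
  have : FiniteDimensional K (gr 1) := Module.finite_of_finrank_pos (by omega)
  let L : g → (gr 1 →ₗ[K] g) := fun y =>
    { toFun := fun x => ⁅(x : g), y⁆
      map_add' := fun a b => by simp
      map_smul' := fun a b => by simp }
  have hL : ∀ y (x : gr 1), L y x = ⁅(x : g), y⁆ := fun y x => rfl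
  -- choice of the second basis vector
  obtain ⟨e2, he2, hne2⟩ : ∃ e : gr 1, ⁅(e : g), f 2⁆ = 0 ∧ e ≠ 0 := by
    have h3 : Module.Finite K (gr 3) ∧ finrank K (gr 3) < 2 := by
      by_cases h : 3 ≤ n - 1
      · have := hα 3 (by omega) h
        exact ⟨Module.finite_of_finrank_pos (by omega), by omega⟩
      · rw [htop 3 (by omega)]
        exact ⟨inferInstance, by simp⟩
    have := h3.1
    let M : gr 1 →ₗ[K] gr 3 := (L (f 2)).codRestrict (gr 3)
      (fun x => hbr 1 2 x (f 2) x.2 (hfm 2))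
    have hM : LinearMap.ker M ≠ ⊥ := LinearMap.ker_ne_bot_of_finrank_lt (by omega)
    obtain ⟨y, hy, hy0⟩ := (Submodule.ne_bot_iff _).mp hM
    exact ⟨y, congrArg Subtype.val (LinearMap.mem_ker.1 hy), hy0⟩
  -- choice of the first one
  let p : Fin n → Submodule K (gr 1) := fun α =>
    if 2 ≤ (α : ℕ) ∧ (α : ℕ) + 2 ≤ n then LinearMap.ker (L (f α)) else Submodule.span K {e2}
  obtain ⟨e1, he1⟩ := Submodule.exists_forall_notMem_of_forall_ne_top p (by
    intro α
    by_cases h : 2 ≤ (α : ℕ) ∧ (α : ℕ) + 2 ≤ n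
    · simp only [p, if_pos h]
      intro htp
      obtain ⟨x, hx, y, hy, hxy⟩ := hex α (by omega) h.2
      obtain ⟨c, rfl⟩ := Submodule.mem_span_singleton.1 (hfs α h.1 hy)
      have : (⟨x, hx⟩ : gr 1) ∈ LinearMap.ker (L (f α)) := htp ▸ Submodule.mem_top
      rw [LinearMap.mem_ker, hL] at this
      apply hxy
      rw [lie_smul, this, smul_zero]
    · simp only [p, if_neg h]
      intro htp
      have := finrank_span_singleton (K := K) hne2
      rw [htp, finrank_top] at this
      omega)
  have he1s : e1 ∉ Submodule.span K {e2} := by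
    have := he1 ⟨0, by omega⟩
    simpa [p] using this
  have he1f : ∀ α, 2 ≤ α → α + 2 ≤ n → ⁅(e1 : g), f α⁆ ≠ 0 := by
    intro α h2 h3 h
    have := he1 ⟨α, by omega⟩
    simp only [p, if_pos (show 2 ≤ α ∧ α + 2 ≤ n from ⟨h2, h3⟩)] at this
    exact this h
  have hspan : gr 1 ≤ Submodule.span K {(e1 : g), (e2 : g)} := by
    have hli : LinearIndependent K ![e2, e1] := 
      (LinearIndependent.pair_iff' hne2).2 fun a h =>
        he1s (Submodule.mem_span_singleton.2 ⟨a, h⟩)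
    have := hli.span_eq_top_of_card_eq_finrank' (by simp [h1])
    intro y hy
    have h2 : (⟨y, hy⟩ : gr 1) ∈ Submodule.span K (Set.range ![e2, e1]) :=
      this ▸ Submodule.mem_top
    rw [Matrix.range_cons, Matrix.range_cons, Matrix.range_empty, Set.union_empty,
      Set.singleton_union, Submodule.mem_span_pair] at h2
    obtain ⟨a, b, h⟩ := h2
    refine Submodule.mem_span_pair.2 ⟨b, a, ?_⟩
    rw [add_comm]
    exact congrArg Subtype.val h
  let w : ℕ → g := fun k => Nat.rec (e2 : g) (fun _ v => ⁅(e1 : g), v⁆) k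
  have hs : ∀ k, w (k + 1) = ⁅(e1 : g), w k⁆ := fun k => rfl
  have hw0 : w 0 = e2 := rfl
  have hmem : ∀ k, w k ∈ gr (k + 1) := by
    intro k
    induction k with
    | zero => exact e2.2
    | succ k ih => rw [hs, add_comm (k + 1) 1]; exact hbr 1 (k + 1) _ _ e1.2 ih
  have hne : ∀ k, k + 2 ≤ n → w k ≠ 0 := by
    intro k
    induction k with
    | zero => intro _ h; exact hne2 (Subtype.ext h)
    | succ k ih =>
      intro hk h
      rw [hs] at h
      rcases Nat.eq_zero_or_pos k with rfl | hkp
      · obtain ⟨x, hx, y, hy, hxy⟩ := hex 1 le_rfl (by omega)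
        obtain ⟨a, b, rfl⟩ := Submodule.mem_span_pair.1 (hspan hx)
        obtain ⟨c, d, rfl⟩ := Submodule.mem_span_pair.1 (hspan hy)
        apply hxy
        rw [hw0] at h
        have h' : ⁅(e2 : g), (e1 : g)⁆ = 0 := by rw [← lie_skew, h, neg_zero]
        simp [h, h']
      · obtain ⟨c, hc⟩ := Submodule.mem_span_singleton.1 (hfs (k + 1) (by omega) (hmem k))
        rw [← hc, lie_smul] at h
        rcases smul_eq_zero.1 h with h | h
        · apply ih (by omega)
          rw [← hc, h, zero_smul]
        · exact he1f (k + 1) (by omega) (by omega) h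
  refine ⟨e1, w, hs, ?_, hspan, hmem, hne, ?_⟩
  · obtain ⟨c, hc⟩ := Submodule.mem_span_singleton.1 (hfs 2 le_rfl (hmem 1))
    rw [← hc, hw0, lie_smul, he2, smul_zero]
  · intro k hk y hy
    by_cases hkn : k + 2 ≤ n
    · obtain ⟨c, hc⟩ := Submodule.mem_span_singleton.1 (hfs (k + 1) (by omega) (hmem k))
      obtain ⟨d, hd⟩ := Submodule.mem_span_singleton.1 (hfs (k + 1) (by omega) hy)
      have hc0 : c ≠ 0 := by
        rintro rfl
        exact hne k hkn (by rw [← hc, zero_smul])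
      refine Submodule.mem_span_singleton.2 ⟨d * c⁻¹, ?_⟩
      rw [← hc, ← hd, smul_smul, mul_assoc, inv_mul_cancel₀ hc0, mul_one]
    · rw [htop (k + 1) (by omega)] at hy
      exact (Submodule.mem_bot K).1 hy ▸ Submodule.zero_mem _

end setup

section fin
variable {K : Type*} [Field K] {g : Type*} [LieRing g] [LieAlgebra K g]

/-- Enumeration of the basis, with a scaling factor. -/
def enum (x : g) (w : ℕ → g) (l : K) : ℕ → g
  | 0 => 0
  | 1 => x
  | k + 2 => l • w k

theorem enum_props (n : ℕ) (hn : 2 ≤ n) (hfr : Module.finrank K g = n)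
    (gr : ℕ → Submodule K g)
    (h0 : gr 0 = ⊥)
    (htop : ∀ α : ℕ, n ≤ α → gr α = ⊥)
    (hsup : (⨆ α : ℕ, gr α) = ⊤)
    (x : g) (w : ℕ → g) (hs : ∀ k, w (k + 1) = ⁅x, w k⁆)
    (hspan : gr 1 ≤ Submodule.span K {x, w 0}) (hmem : ∀ k, w k ∈ gr (k + 1))
    (hspan' : ∀ k, 1 ≤ k → gr (k + 1) ≤ Submodule.span K {w k})
    (l : K) (hl : l ≠ 0) :
    (∃ b : Basis (Fin n) K g, ∀ i : Fin n, enum x w l ((i : ℕ) + 1) = b i) ∧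
    (∀ m : ℕ, m = 0 ∨ n < m → enum x w l m = 0) ∧
    (∀ i : ℕ, 2 ≤ i → i ≤ n - 1 → ⁅enum x w l 1, enum x w l i⁆ = enum x w l (i + 1)) ∧
    ⁅enum x w l 1, enum x w l n⁆ = 0 := by
  have hw0 : ∀ k, n ≤ k + 1 → w k = 0 := by
    intro k hk
    have := hmem k
    rw [htop _ hk] at this
    exact (Submodule.mem_bot K).1 this
  have hst : ∀ i, 2 ≤ i → ⁅enum x w l 1, enum x w l i⁆ = enum x w l (i + 1) := by
    intro i hi
    obtain ⟨k, rfl⟩ : ∃ k, i = k + 2 := ⟨i - 2, by omega⟩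
    change ⁅x, l • w k⁆ = l • w (k + 1)
    rw [lie_smul, hs]
  have hz : ∀ m : ℕ, m = 0 ∨ n < m → enum x w l m = 0 := by
    rintro m (rfl | hm)
    · rfl
    · obtain ⟨k, rfl⟩ : ∃ k, m = k + 2 := ⟨m - 2, by omega⟩
      change l • w k = 0
      rw [hw0 k (by omega), smul_zero]
  refine ⟨?_, hz, fun i hi _ => hst i hi, ?_⟩
  · let v : Fin n → g := fun i => enum x w l ((i : ℕ) + 1)
    have hx : x ∈ Submodule.span K (Set.range v) :=
      Submodule.subset_span ⟨⟨0, by omega⟩, rfl⟩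
    have hw : ∀ k, w k ∈ Submodule.span K (Set.range v) := by
      intro k
      by_cases hk : n ≤ k + 1
      · rw [hw0 k hk]; exact Submodule.zero_mem _
      · have : l • w k ∈ Submodule.span K (Set.range v) :=
          Submodule.subset_span ⟨⟨k + 1, by omega⟩, rfl⟩
        exact (Submodule.smul_mem_iff _ hl).1 this
    have hle : ⊤ ≤ Submodule.span K (Set.range v) := by
      rw [← hsup]
      refine iSup_le fun α => ?_
      match α with
      | 0 => rw [h0]; exact bot_le
      | 1 =>
        refine hspan.trans (Submodule.span_le.2 ?_)
        rintro y (rfl | rfl)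
        · exact hx
        · exact hw 0
      | k + 2 =>
        refine (hspan' (k + 1) (by omega)).trans (Submodule.span_le.2 ?_)
        rintro y rfl
        exact hw (k + 1)
    refine ⟨basisOfTopLeSpanOfCardEqFinrank v hle (by simp [hfr]), fun i => ?_⟩
    rw [coe_basisOfTopLeSpanOfCardEqFinrank]
  · rw [hst n hn, hz _ (Or.inr (by omega))]

end fin

/-- Vergne: a graded filiform Lie algebra `g = ⊕_{α ≥ 1} g_α` of
dimension `n` with `dim g_1 = 2` and `dim g_α = 1` for `2 ≤ α ≤ n - 1` is isomorphic to
`m_0(n)` when `n` is odd, and to `m_0(2k)` or `m_1(2k)` when `n = 2k` is even. -/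
theorem statement18 {K : Type*} [Field K] [CharZero K]
    {g : Type*} [LieRing g] [LieAlgebra K g]
    (n : ℕ) (hfil : IsFiliform K g n)
    (gr : ℕ → Submodule K g)
    (h0 : gr 0 = ⊥)
    (htop : ∀ α : ℕ, n ≤ α → gr α = ⊥)
    (hbr : ∀ (α β : ℕ) (x y : g), x ∈ gr α → y ∈ gr β → ⁅x, y⁆ ∈ gr (α + β))
    (hsup : (⨆ α : ℕ, gr α) = ⊤)
    (h1 : Module.finrank K (gr 1) = 2)
    (hα : ∀ α : ℕ, 2 ≤ α → α ≤ n - 1 → Module.finrank K (gr α) = 1) :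
    (Odd n → ∃ E : ℕ → g, IsM0Basis K n E) ∧
    (∀ k : ℕ, n = 2 * k →
      (∃ E : ℕ → g, IsM0Basis K n E) ∨ (∃ E : ℕ → g, IsM1Basis K k E)) := by
  obtain ⟨hfr, hl, -⟩ := hfil
  have hn : 2 ≤ n := by
    by_contra hn
    rw [htop 1 (by omega), finrank_bot] at h1
    omega
  obtain ⟨x, w, hs, h01, hspan, hmem, hne, hspan'⟩ :=
    setup n hn hl gr h0 htop hbr hsup h1 hα
  have hprops := enum_props n hn hfr gr h0 htop hsup x w hs hspan hmem hspan'
  have hbw : ∀ a b, ⁅w a, w b⁆ ∈ gr (a + b + 2) := fun a b => by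
    rw [show a + b + 2 = (a + 1) + (b + 1) by omega]
    exact hbr _ _ _ _ (hmem a) (hmem b)
  have hgen : ∀ a b, ∃ c : K, ⁅w a, w b⁆ = c • w (a + b + 1) := by
    intro a b
    obtain ⟨c, hc⟩ := Submodule.mem_span_singleton.1 (hspan' (a + b + 1) (by omega) (hbw a b))
    exact ⟨c, hc.symm⟩
  have hlow := core (K := K) n x w hs h01 hgen hne
  have hhigh : ∀ a b, n ≤ a + b + 2 → ⁅w a, w b⁆ = 0 := by
    intro a b hab
    have := hbw a b
    rw [htop _ hab] at this
    exact (Submodule.mem_bot K).1 this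
  have hM0 : (∀ a b, a + b + 3 = n → ⁅w a, w b⁆ = 0) → ∃ E : ℕ → g, IsM0Basis K n E := by
    intro hmid
    obtain ⟨p1, p2, p3, p4⟩ := hprops 1 one_ne_zero
    refine ⟨enum x w (1 : K), p1, p2, p3, p4, ?_⟩
    intro i j hi hij hj
    obtain ⟨a, rfl⟩ : ∃ a, i = a + 2 := ⟨i - 2, by omega⟩
    obtain ⟨b, rfl⟩ : ∃ b, j = b + 2 := ⟨j - 2, by omega⟩
    change ⁅(1 : K) • w a, (1 : K) • w b⁆ = 0
    rw [one_smul, one_smul]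
    rcases lt_trichotomy (a + b + 3) n with h | h | h
    · exact hlow (a + b) (by omega) a b rfl
    · exact hmid a b h
    · exact hhigh a b (by omega)
  constructor
  · rintro ⟨m, hm⟩
    apply hM0
    intro a b hab
    by_cases hm1 : m = 1
    · obtain rfl : a = 0 := by omega
      obtain rfl : b = 0 := by omega
      exact lie_self _
    · exact core_even K x w hs (n - 4) (m - 1) (by omega) (hlow (n - 4) (by omega)) a b (by omega)
  · intro k hk
    by_cases hk1 : k = 1
    · left
      apply hM0
      intro a b hab
      omega
    have halt := core_alt (K := K) x w hs (n - 4) (hlow (n - 4) (by omega))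
    obtain ⟨c, hc⟩ := hgen 0 (n - 4 + 1)
    rw [hc, show 0 + (n - 4 + 1) + 1 = n - 2 by omega] at halt
    by_cases hc0 : c = 0
    · left
      apply hM0
      intro a b hab
      rw [halt a b (by omega), hc0, zero_smul, smul_zero]
    · right
      obtain ⟨p1, p2, p3, p4⟩ := hprops (-c⁻¹) (neg_ne_zero.2 (inv_ne_zero hc0))
      subst hk
      refine ⟨enum x w (-c⁻¹), p1, p2, p3, p4, ?_⟩
      intro i j hi hij hj
      obtain ⟨a, rfl⟩ : ∃ a, i = a + 2 := ⟨i - 2, by omega⟩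
      obtain ⟨b, rfl⟩ : ∃ b, j = b + 2 := ⟨j - 2, by omega⟩
      have hE : enum x w (-c⁻¹) (2 * k) = (-c⁻¹) • w (2 * k - 2) := by
        obtain ⟨q, hq⟩ : ∃ q, 2 * k = q + 2 := ⟨2 * k - 2, by omega⟩
        rw [hq]; rfl
      rw [hE]
      change ⁅(-c⁻¹) • w a, (-c⁻¹) • w b⁆ = _
      rw [smul_lie, lie_smul]
      rcases lt_trichotomy (a + b + 3) (2 * k) with h | h | h
      · rw [if_neg (by omega), hlow (a + b) (by omega) a b rfl, smul_zero, smul_zero]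
      · rw [if_pos (by omega), halt a b (by omega)]
        simp only [smul_smul]
        congr 1
        field_simp
        ring
      · rw [if_neg (by omega), hhigh a b (by omega), smul_zero, smul_zero]

end Paper
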